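/- arXiv:1306.0747 — 2 statements merged into one kernel-verified Lean document; each statement's English description precedes it below -/
import Mathlib

section
/- Let G be a finite group and π a set of primes such that d_π(G) < 1. If 3 ∉ π or |G| is odd, then d_π(G) ≤ 5/8. -/
open scoped Classical Pointwise

/-- A `π`-element: every prime divisor of its order lies in `π`. -/
def IsPiElement {G : Type*} [Group G] (π : Set ℕ) (x : G) : Prop :=
  ∀ q : ℕ, q.Prime → q ∣ orderOf x → q ∈ π

/-- `kPi π G` is the number of conjugacy classes of `π`-elements of `G`. -/
noncomputable def kPi (π : Set ℕ) (G : Type*) [Group G] : ℕ :=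
  Nat.card {c : ConjClasses G | ∃ x : G, ConjClasses.mk x = c ∧ IsPiElement π x}

/-- The `π`-part of a natural number: the largest divisor all of whose prime
divisors lie in `π`. -/
noncomputable def piPart (π : Set ℕ) (n : ℕ) : ℕ :=
  n.factorization.prod fun p k => if p ∈ π then p ^ k else 1

/-- `dPi π G = kPi π G / |G|_π`. -/
noncomputable def dPi (π : Set ℕ) (G : Type*) [Group G] : ℚ :=
  (kPi π G : ℚ) / (piPart π (Nat.card G) : ℚ)


lemma exists_coprime_decomp {G : Type*} [Group G] (z : G) (a b : ℕ) (hab : a.Coprime b)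
    (hz : z ^ (a * b) = 1) :
    ∃ x y : G, x ∈ Subgroup.zpowers z ∧ y ∈ Subgroup.zpowers z ∧ x ^ a = 1 ∧ y ^ b = 1 ∧
      x * y = z := by
  have hb : ((a : ℤ) * a.gcdA b + b * a.gcdB b) = 1 := by
    rw [← Nat.gcd_eq_gcd_ab, hab.gcd_eq_one]; rfl
  have hz' : z ^ ((a : ℤ) * b) = 1 := by exact_mod_cast hz
  refine ⟨z ^ ((b : ℤ) * a.gcdB b), z ^ ((a : ℤ) * a.gcdA b),
    Subgroup.zpow_mem_zpowers _ _, Subgroup.zpow_mem_zpowers _ _, ?_, ?_, ?_⟩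
  · rw [← zpow_natCast, ← zpow_mul, show (b : ℤ) * a.gcdB b * a = (a * b) * a.gcdB b by ring,
      zpow_mul, hz', one_zpow]
  · rw [← zpow_natCast, ← zpow_mul, show (a : ℤ) * a.gcdA b * b = (a * b) * a.gcdA b by ring,
      zpow_mul, hz', one_zpow]
  · rw [← zpow_add, add_comm, hb, zpow_one]

lemma count_fibres {X Y : Type*} [Finite X] (f : X → Y) (hf : Function.Surjective f)
    (C : Set X) (r : ℕ)
    (h : ∀ x, x ∉ C → ∃ S : Finset X, r ≤ S.card ∧ ∀ s ∈ S, s ∉ C ∧ f s = f x) :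
    r * Nat.card Y + Nat.card C ≤ r * Nat.card C + Nat.card X := by
  have := Fintype.ofFinite X
  have : Finite Y := Finite.of_surjective f hf
  have := Fintype.ofFinite Y
  set D : Finset X := C.toFinset with hD
  have hC : Nat.card C = D.card := by rw [Nat.card_eq_fintype_card, hD, Set.toFinset_card]
  rw [hC, Nat.card_eq_fintype_card, Nat.card_eq_fintype_card]
  have h1 : r * (Dᶜ.image f).card ≤ Dᶜ.card := by
    apply Finset.mul_card_image_le_card
    intro b hb
    obtain ⟨x, hx, rfl⟩ := Finset.mem_image.1 hb
    obtain ⟨S, hS, hS'⟩ := h x (by simpa [hD] using hx)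
    refine hS.trans (Finset.card_le_card ?_)
    intro s hs
    simpa [hD] using hS' s hs
  have h2 : Fintype.card Y ≤ D.card + (Dᶜ.image f).card := by
    rw [← Finset.card_univ]
    have : (Finset.univ : Finset Y) ⊆ D.image f ∪ Dᶜ.image f := by
      intro y _
      obtain ⟨x, rfl⟩ := hf y
      rw [← Finset.image_union, Finset.union_compl]
      exact Finset.mem_image_of_mem _ (Finset.mem_univ _)
    calc _ ≤ _ := Finset.card_le_card this
      _ ≤ _ := Finset.card_union_le _ _
      _ ≤ _ := by gcongr; exact Finset.card_image_le
  have h3 : D.card + Dᶜ.card = Fintype.card X := Finset.card_add_card_compl D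
  calc _ ≤ r * (D.card + (Dᶜ.image f).card) + D.card := by gcongr
    _ = r * D.card + (D.card + r * (Dᶜ.image f).card) := by ring
    _ ≤ _ := by rw [← h3]; gcongr

lemma isPiElement_of_pow {G : Type*} [Group G] {π : Set ℕ} {x : G} {n : ℕ} (h : x ^ n = 1)
    (hn : ∀ q : ℕ, q.Prime → q ∣ n → q ∈ π) : IsPiElement π x :=
  fun q hq hd => hn q hq (hd.trans (orderOf_dvd_of_pow_eq_one h))

lemma isPiElement_conj {G : Type*} [Group G] {π : Set ℕ} {x y : G} (h : IsConj x y)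
    (hx : IsPiElement π x) : IsPiElement π y := by
  obtain ⟨c, rfl⟩ := isConj_iff.1 h
  intro q hq hd
  apply hx q hq
  have := MulEquiv.orderOf_eq (MulAut.conj c) x
  rw [MulAut.conj_apply] at this
  rwa [← this]

/-- p-elements: order is a power of p -/
lemma pow_of_isPiElement {G : Type*} [Group G] [Finite G] {p : ℕ} {x : G}
    (hx : IsPiElement {p} x) : ∃ k, x ^ p ^ k = 1 := by
  have h0 : orderOf x ≠ 0 := (orderOf_pos x).ne'
  have := Nat.eq_prime_pow_of_unique_prime_dvd h0 (p := p) (fun {d} hd h => hx d hd h)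
  exact ⟨_, this ▸ pow_orderOf_eq_one x⟩

abbrev PiClasses (π : Set ℕ) (G : Type*) [Group G] :=
  {c : ConjClasses G | ∃ x : G, ConjClasses.mk x = c ∧ IsPiElement π x}

noncomputable def sylowToClass {G : Type*} [Group G] [Finite G] {p : ℕ} [Fact p.Prime]
    (P : Sylow p G) (x : P) : PiClasses {p} G :=
  ⟨ConjClasses.mk (x : G), x, rfl, by
    obtain ⟨k, hk⟩ := isPGroup_iff_pow_pow_eq_one.1 P.isPGroup' x
    refine isPiElement_of_pow (n := p ^ k) (by exact_mod_cast congrArg Subtype.val hk) ?_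
    intro q hq hd
    exact (Nat.prime_dvd_prime_iff_eq hq Fact.out).1 (hq.dvd_of_dvd_pow hd)⟩

lemma sylowToClass_surj {G : Type*} [Group G] [Finite G] {p : ℕ} [Fact p.Prime]
    (P : Sylow p G) : Function.Surjective (sylowToClass P) := by
  rintro ⟨c, x, rfl, hx⟩
  obtain ⟨k, hk⟩ := pow_of_isPiElement hx
  have hpx : IsPGroup p (Subgroup.zpowers x) :=
    IsPGroup.of_card_dvd_pow (n := k) (by rw [Nat.card_zpowers]; exact orderOf_dvd_of_pow_eq_one hk)
  obtain ⟨Q, hQ⟩ := hpx.exists_le_sylow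
  obtain ⟨g, hg⟩ := MulAction.exists_smul_eq G Q P
  have hx' : g * x * g⁻¹ ∈ P := by
    rw [← hg]
    have : MulAut.conj g • x ∈ MulAut.conj g • (Q : Subgroup G) :=
      Subgroup.smul_mem_pointwise_smul _ _ _ (hQ (Subgroup.mem_zpowers x))
    exact this
  refine ⟨⟨_, hx'⟩, ?_⟩
  apply Subtype.ext
  change ConjClasses.mk _ = ConjClasses.mk _
  rw [ConjClasses.mk_eq_mk_iff_isConj]
  exact (isConj_iff.2 ⟨g, rfl⟩).symm

lemma sylowToClass_eq {G : Type*} [Group G] [Finite G] {p : ℕ} [Fact p.Prime]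
    (P : Sylow p G) (x y : P) (g : G) (h : g * x * g⁻¹ = y) :
    sylowToClass P y = sylowToClass P x := by
  apply Subtype.ext
  change ConjClasses.mk _ = ConjClasses.mk _
  rw [ConjClasses.mk_eq_mk_iff_isConj]
  exact (isConj_iff.2 ⟨g, h⟩).symm

lemma kPi_prime_le {G : Type*} [Group G] [Finite G] {p : ℕ} (hp : p.Prime) :
    kPi {p} G ≤ p ^ (Nat.card G).factorization p := by
  have := Fact.mk hp
  let P : Sylow p G := default
  rw [← P.card_eq_multiplicity]
  exact Nat.card_le_card_of_surjective _ (sylowToClass_surj P)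

lemma nonabelian_case {G : Type*} [Group G] [Finite G] {p : ℕ} [Fact p.Prime]
    (P : Sylow p G) (hP : ¬ ∀ a b : P, a * b = b * a) :
    8 * kPi {p} G ≤ 5 * Nat.card P := by
  have hidx : 4 ≤ (Subgroup.center P).index := by
    by_contra hlt
    apply hP
    have h0 : (Subgroup.center P).index ≠ 0 := Subgroup.index_ne_zero_of_finite
    have hcyc : IsCyclic (P ⧸ Subgroup.center P) := by
      have hc : Nat.card (P ⧸ Subgroup.center P) = (Subgroup.center P).index := rfl
      have : (Subgroup.center P).index = 1 ∨ (Subgroup.center P).index = 2 ∨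
        (Subgroup.center P).index = 3 := by omega
      rcases this with h | h | h
      · rw [h] at hc
        have := (Nat.card_eq_one_iff_unique.1 hc).1
        exact isCyclic_of_subsingleton
      · have : Fact (Nat.Prime 2) := ⟨Nat.prime_two⟩
        exact isCyclic_of_prime_card (hc.trans h)
      · have : Fact (Nat.Prime 3) := ⟨Nat.prime_three⟩
        exact isCyclic_of_prime_card (hc.trans h)
    have := isMulCommutative_of_isCyclic_quotient_center_self P
    intro a b
    exact this.is_comm.comm a b
  have hcard := (Subgroup.center P).card_mul_index
  have key := count_fibres (sylowToClass P) (sylowToClass_surj P) (Subgroup.center P : Set P) 2 (by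
    intro x hx
    have hx0 : ¬ ∀ g : P, g * x = x * g := fun h => hx (Subgroup.mem_center_iff.2 h)
    push Not at hx0
    obtain ⟨g, hg⟩ := hx0
    refine ⟨{x, g * x * g⁻¹}, ?_, ?_⟩
    · rw [Finset.card_pair]
      intro h
      apply hg
      conv_rhs => rw [h]
      group
    · intro s hs
      rw [Finset.mem_insert, Finset.mem_singleton] at hs
      rcases hs with rfl | rfl
      · exact ⟨hx, rfl⟩
      · refine ⟨fun h => hx ?_, sylowToClass_eq P _ _ g (by simp)⟩
        have := (inferInstance : (Subgroup.center P).Normal).conj_mem _ h g⁻¹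
        simpa [mul_assoc] using this)
  have hk : Nat.card (PiClasses {p} G) = kPi {p} G := rfl
  have hZ : Nat.card ((Subgroup.center P : Set P)) = Nat.card (Subgroup.center P) := rfl
  rw [hk, hZ] at key
  change _ ≤ _ + Nat.card (P : Subgroup G) at key
  have : Nat.card (Subgroup.center P) * 4 ≤ Nat.card P := by
    rw [← hcard]; gcongr
  omega

lemma abelian_case {G : Type*} [Group G] [Finite G] {p : ℕ} [Fact p.Prime]
    (P : Sylow p G) (hP : ∀ a b : P, a * b = b * a)
    (h3 : p ≠ 3 ∨ Odd (Nat.card G))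
    (hN : ¬ Subgroup.normalizer (P : Set G) ≤ Subgroup.centralizer (P : Set G)) :
    8 * kPi {p} G ≤ 5 * Nat.card P := by
  have hp : p.Prime := Fact.out
  obtain ⟨g, hgN, hgC⟩ := SetLike.not_le_iff_exists.1 hN
  set m := (P : Subgroup G).index with hm
  have hpm : ¬ p ∣ m := P.not_dvd_index
  have hcG : Nat.card P * m = Nat.card G := (P : Subgroup G).card_mul_index
  have hPc := P.card_eq_multiplicity
  have hcop : (Nat.card P).Coprime m := by
    rw [hPc]; exact ((Nat.Prime.coprime_iff_not_dvd hp).2 hpm).pow_left _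
  obtain ⟨u, y, hu, hy, hua, hym, huy⟩ := exists_coprime_decomp g (Nat.card P) m hcop
    (by rw [hcG]; exact pow_card_eq_one')
  have huN := (Subgroup.zpowers_le.2 hgN) hu
  have hyN := (Subgroup.zpowers_le.2 hgN) hy
  have huP : u ∈ P := by
    have hpu : IsPGroup p (Subgroup.zpowers u) :=
      IsPGroup.of_card_dvd_pow (n := (Nat.card G).factorization p)
        (by rw [Nat.card_zpowers, ← hPc]; exact orderOf_dvd_of_pow_eq_one hua)
    have := hpu.inf_normalizer_sylow P
    have h2 : u ∈ Subgroup.zpowers u ⊓ Subgroup.normalizer (P : Set G) :=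
      ⟨Subgroup.mem_zpowers u, huN⟩
    rw [this] at h2
    exact h2.2
  have huC : u ∈ Subgroup.centralizer (P : Set G) := by
    rw [Subgroup.mem_centralizer_iff]
    intro h hh
    exact congrArg Subtype.val (hP ⟨h, hh⟩ ⟨u, huP⟩)
  have hyC : y ∉ Subgroup.centralizer (P : Set G) := fun h => hgC (huy ▸ mul_mem huC h)
  have hconj : ∀ x : P, y * x * y⁻¹ ∈ P := fun x => (Subgroup.mem_normalizer_iff.1 hyN x).1 x.2
  let α : P → P := fun x => ⟨y * x * y⁻¹, hconj x⟩
  have hα : ∀ n x, ((α^[n] x : P) : G) = y ^ n * x * (y ^ n)⁻¹ := by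
    intro n
    induction n with
    | zero => intro x; simp
    | succ n ih =>
      intro x
      rw [Function.iterate_succ_apply', pow_succ']
      change y * ((α^[n] x : P) : G) * y⁻¹ = _
      rw [ih]; group
  have hαm : ∀ x, Function.IsPeriodicPt α m x := by
    intro x
    apply Subtype.ext
    rw [hα, hym]; simp
  let C : Subgroup P := (Subgroup.centralizer {y}).subgroupOf P
  have hC : ∀ x, x ∈ C ↔ α x = x := by
    intro x
    rw [Subgroup.mem_subgroupOf, Subgroup.mem_centralizer_singleton_iff, Subtype.ext_iff]
    change _ ↔ y * x * y⁻¹ = x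
    rw [mul_inv_eq_iff_eq_mul]
    exact eq_comm
  have hCne : C ≠ ⊤ := by
    intro h
    apply hyC
    rw [Subgroup.mem_centralizer_iff]
    intro x hx
    have : (⟨x, hx⟩ : P) ∈ C := h ▸ Subgroup.mem_top _
    rw [Subgroup.mem_subgroupOf, Subgroup.mem_centralizer_singleton_iff] at this
    exact this
  have hinj : ∀ x, α x ∈ C → x ∈ C := by
    intro x h
    rw [hC] at h ⊢
    have h' := congrArg Subtype.val h
    apply Subtype.ext
    change y * (y * x * y⁻¹) * y⁻¹ = y * x * y⁻¹ at h'
    exact mul_left_cancel (mul_right_cancel h')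
  have hcl : ∀ x, sylowToClass P (α x) = sylowToClass P x := fun x =>
    sylowToClass_eq P _ _ y rfl
  obtain ⟨n, hn⟩ := P.isPGroup'.index C
  have hn0 : n ≠ 0 := by
    rintro rfl
    exact hCne (Subgroup.index_eq_one.1 (by simpa using hn))
  have hpi : p ∣ C.index := hn ▸ dvd_pow_self p hn0
  have hi0 : C.index ≠ 0 := Subgroup.index_ne_zero_of_finite
  have hcard := C.card_mul_index
  have hk : Nat.card (PiClasses {p} G) = kPi {p} G := rfl
  have hZ : Nat.card ((C : Set P)) = Nat.card C := rfl
  by_cases hp5 : 5 ≤ p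
  · have key := count_fibres (sylowToClass P) (sylowToClass_surj P) (C : Set P) 2 (by
      intro x hx
      have hx0 : x ∉ C := hx
      refine ⟨{x, α x}, ?_, ?_⟩
      · rw [Finset.card_pair]
        intro h
        exact hx0 ((hC x).2 h.symm)
      · intro s hs
        rw [Finset.mem_insert, Finset.mem_singleton] at hs
        rcases hs with rfl | rfl
        · exact ⟨hx, rfl⟩
        · exact ⟨fun h => hx (hinj _ h), hcl _⟩)
    rw [hk, hZ] at key
    change _ ≤ _ + Nat.card (P : Subgroup G) at key
    have : Nat.card C * 5 ≤ Nat.card P := by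
      rw [← hcard]; gcongr; exact hp5.trans (Nat.le_of_dvd (Nat.pos_of_ne_zero hi0) hpi)
    omega
  · have hp23 : p = 2 ∨ p = 3 := by
      have := hp.two_le
      have h4 : p ≠ 4 := by rintro rfl; revert hp; decide
      omega
    have hmodd : Odd m := by
      rcases hp23 with rfl | rfl
      · rwa [← Nat.not_even_iff_odd, even_iff_two_dvd]
      · have h := h3.resolve_left (by simp)
        rw [← hcG] at h
        exact (Nat.odd_mul.1 h).2
    have hsq : ∀ x, α (α x) = x → α x = x := by
      intro x h
      have h2 : Function.IsPeriodicPt α 2 x := h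
      have := h2.gcd (hαm x)
      rw [(Nat.coprime_two_left.2 hmodd).gcd_eq_one] at this
      exact this
    have hi3 : 3 ≤ C.index := by
      have h1 : C.index ≠ 1 := fun h => hCne (Subgroup.index_eq_one.1 h)
      have h2 : C.index ≠ 2 := by
        intro h2
        obtain ⟨x, hx⟩ : ∃ x, x ∉ C := by
          by_contra hh; push Not at hh; exact hCne (eq_top_iff.2 fun x _ => hh x)
        have hax : α x ∉ C := fun h => hx (hinj _ h)
        have hc : x⁻¹ * α x ∈ C := by
          rw [Subgroup.mul_mem_iff_of_index_two h2, inv_mem_iff]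
          exact iff_of_false hx hax
        have hc' : ((x⁻¹ * α x : P) : G) * y = y * ((x⁻¹ * α x : P) : G) := by
          rw [Subgroup.mem_subgroupOf, Subgroup.mem_centralizer_singleton_iff] at hc
          exact hc
        have hit : ∀ k, α^[k] x = x * (x⁻¹ * α x) ^ k := by
          intro k
          induction k with
          | zero => simp
          | succ k ih =>
            rw [Function.iterate_succ_apply', ih]
            have e1 : ∀ a b, α (a * b) = α a * α b := by
              intro a b; apply Subtype.ext
              change y * (a * b : G) * y⁻¹ = (y * a * y⁻¹) * (y * b * y⁻¹)
              group
            rw [e1, (hC _).1 (pow_mem hc k), pow_succ', ← mul_assoc, ← mul_assoc, mul_inv_cancel,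
              one_mul]
        have e2 := hit m
        rw [hαm x, left_eq_mul] at e2
        have e3 : (x⁻¹ * α x) ^ Nat.card P = 1 := pow_card_eq_one'
        have e4 : x⁻¹ * α x = 1 := by
          have := Nat.dvd_gcd (orderOf_dvd_of_pow_eq_one e3) (orderOf_dvd_of_pow_eq_one e2)
          rw [hcop.gcd_eq_one, Nat.dvd_one, orderOf_eq_one_iff] at this
          exact this
        exact hx ((hC x).2 (inv_mul_eq_one.1 e4).symm)
      omega
    have key := count_fibres (sylowToClass P) (sylowToClass_surj P) (C : Set P) 3 (by
      intro x hx
      have hx0 : x ∉ C := hx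
      have hx1 : α x ∉ C := fun h => hx (hinj _ h)
      have hx2 : α (α x) ∉ C := fun h => hx1 (hinj _ h)
      refine ⟨{x, α x, α (α x)}, ?_, ?_⟩
      · rw [Finset.card_eq_three.2]
        refine ⟨x, α x, α (α x), ?_, ?_, ?_, rfl⟩
        · intro h
          exact hx0 ((hC x).2 h.symm)
        · intro h
          exact hx0 ((hC x).2 (hsq x h.symm))
        · intro h
          exact hx1 ((hC _).2 h.symm)
      · intro s hs
        rw [Finset.mem_insert, Finset.mem_insert, Finset.mem_singleton] at hs
        rcases hs with rfl | rfl | rfl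
        · exact ⟨hx, rfl⟩
        · exact ⟨hx1, hcl _⟩
        · exact ⟨hx2, (hcl _).trans (hcl _)⟩)
    rw [hk, hZ] at key
    change _ ≤ _ + Nat.card (P : Subgroup G) at key
    have : Nat.card C * 3 ≤ Nat.card P := by
      rw [← hcard]; gcongr
    omega

lemma kPi_insert_le {G : Type*} [Group G] [Finite G] {p : ℕ} (hp : p.Prime) (s : Set ℕ)
    (N : ℕ) (hN : ∀ x : G, kPi s (Subgroup.centralizer {x} : Subgroup G) ≤ N) :
    kPi (insert p s) G ≤ kPi {p} G * N := by
  have := Fintype.ofFinite (PiClasses {p} G)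
  let rep : PiClasses {p} G → G := fun c => c.2.choose
  have hrep : ∀ c : PiClasses {p} G, ConjClasses.mk (rep c) = c.1 := fun c => c.2.choose_spec.1
  let T := Σ c : PiClasses {p} G, PiClasses s (Subgroup.centralizer {rep c} : Subgroup G)
  let F : T → ConjClasses G := fun t => ConjClasses.mk (rep t.1 * (t.2.2.choose : G))
  have hsub : PiClasses (insert p s) G ⊆ Set.range F := by
    rintro _ ⟨z, rfl, hz⟩
    have hz0 : orderOf z ≠ 0 := (orderOf_pos z).ne'
    obtain ⟨x, y, hx, hy, hxa, hyb, hxy⟩ := exists_coprime_decomp z (ordProj[p] (orderOf z))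
      (ordCompl[p] (orderOf z)) ((Nat.coprime_ordCompl hp hz0).pow_left _)
      (by rw [Nat.ordProj_mul_ordCompl_eq_self]; exact pow_orderOf_eq_one z)
    have hxp : IsPiElement {p} x := isPiElement_of_pow hxa fun q hq hd =>
      (Nat.prime_dvd_prime_iff_eq hq hp).1 (hq.dvd_of_dvd_pow hd)
    have hys : IsPiElement s y := isPiElement_of_pow hyb fun q hq hd => by
      rcases hz q hq (hd.trans (Nat.ordCompl_dvd _ _)) with rfl | h
      · exact absurd hd (Nat.not_dvd_ordCompl hq hz0)
      · exact h
    have hcomm : x * y = y * x := by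
      obtain ⟨i, rfl⟩ := hx
      obtain ⟨j, rfl⟩ := hy
      exact (Commute.refl z).zpow_zpow i j
    let c : PiClasses {p} G := ⟨ConjClasses.mk x, x, rfl, hxp⟩
    obtain ⟨g, hg⟩ := isConj_iff.1 (ConjClasses.mk_eq_mk_iff_isConj.1 (hrep c).symm)
    let y' : G := g * y * g⁻¹
    have hy' : y' ∈ Subgroup.centralizer {rep c} := by
      rw [Subgroup.mem_centralizer_singleton_iff, ← hg]
      have : g * (x * y) * g⁻¹ = g * (y * x) * g⁻¹ := by rw [hcomm]
      simp only [y']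
      simpa [mul_assoc] using this.symm
    have hyS2 : IsPiElement s (⟨y', hy'⟩ : (Subgroup.centralizer {rep c} : Subgroup G)) := by
      intro q hq hd
      rw [Subgroup.orderOf_mk] at hd
      exact isPiElement_conj (isConj_iff.2 ⟨g, rfl⟩) hys q hq hd
    let d : PiClasses s (Subgroup.centralizer {rep c} : Subgroup G) :=
      ⟨ConjClasses.mk ⟨y', hy'⟩, _, rfl, hyS2⟩
    refine ⟨⟨c, d⟩, ?_⟩
    change ConjClasses.mk (rep c * (d.2.choose : G)) = _
    have hd := d.2.choose_spec.1
    obtain ⟨⟨u, hu⟩, hu'⟩ := isConj_iff.1 (ConjClasses.mk_eq_mk_iff_isConj.1 hd)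
    have hu2 : u * (d.2.choose : G) * u⁻¹ = y' := congrArg Subtype.val hu'
    rw [Subgroup.mem_centralizer_singleton_iff] at hu
    rw [ConjClasses.mk_eq_mk_iff_isConj]
    have e1 : IsConj (rep c * (d.2.choose : G)) (rep c * y') := by
      refine isConj_iff.2 ⟨u, ?_⟩
      rw [← hu2]
      calc _ = (u * rep c) * (d.2.choose : G) * u⁻¹ := by group
        _ = _ := by rw [hu]; group
    refine e1.trans (IsConj.symm (isConj_iff.2 ⟨g, ?_⟩))
    rw [← hxy, ← hg]
    simp only [y']
    group
  have hT : Nat.card T = ∑ c : PiClasses {p} G,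
      kPi s (Subgroup.centralizer {rep c} : Subgroup G) := by
    rw [Nat.card_sigma]; rfl
  have h1 : kPi (insert p s) G ≤ Nat.card T := by
    calc Nat.card (PiClasses (insert p s) G) ≤ Nat.card (Set.range F) :=
          Nat.card_mono (Set.toFinite _) hsub
      _ ≤ _ := Finite.card_range_le F
  calc _ ≤ _ := h1
    _ = _ := hT
    _ ≤ ∑ c : PiClasses {p} G, N := Finset.sum_le_sum fun c _ => hN _
    _ = kPi {p} G * N := by
      rw [Finset.sum_const, smul_eq_mul, Finset.card_univ, ← Nat.card_eq_fintype_card]; rfl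

lemma kPi_empty {G : Type*} [Group G] [Finite G] : kPi ∅ G ≤ 1 := by
  have : Subsingleton (PiClasses ∅ G) := by
    constructor
    rintro ⟨_, x, rfl, hx⟩ ⟨_, y, rfl, hy⟩
    have key : ∀ x : G, IsPiElement ∅ x → x = 1 := by
      intro x hx
      by_contra h
      rw [← orderOf_eq_one_iff] at h
      exact hx _ (Nat.minFac_prime h) (Nat.minFac_dvd _)
    rw [Subtype.mk.injEq, key x hx, key y hy]
  exact Finite.card_le_one_iff_subsingleton.2 this

lemma prod_mono_subgroup {G : Type*} [Group G] [Finite G] (H : Subgroup G) (s : Finset ℕ)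
    (hs : ∀ q ∈ s, q.Prime) :
    ∏ q ∈ s, q ^ (Nat.card H).factorization q ≤ ∏ q ∈ s, q ^ (Nat.card G).factorization q := by
  refine Finset.prod_le_prod' fun q hq => ?_
  exact Nat.pow_le_pow_right (hs q hq).pos
    ((Nat.factorization_le_iff_dvd Nat.card_pos.ne' Nat.card_pos.ne').2 H.card_subgroup_dvd_card q)

universe u

lemma kPi_le (s : Finset ℕ) (hs : ∀ q ∈ s, q.Prime) : ∀ (G : Type u) [Group G] [Finite G],
    kPi (s : Set ℕ) G ≤ ∏ q ∈ s, q ^ (Nat.card G).factorization q := by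
  induction s using Finset.induction_on with
  | empty => intro G _ _; simpa using kPi_empty
  | insert p s hps ih =>
    intro G _ _
    have hs' : ∀ q ∈ s, q.Prime := fun q hq => hs q (Finset.mem_insert_of_mem hq)
    have hp := hs p (Finset.mem_insert_self _ _)
    rw [Finset.prod_insert hps, Finset.coe_insert]
    refine (kPi_insert_le hp _ (∏ q ∈ s, q ^ (Nat.card G).factorization q)
      fun x => (ih hs' _).trans (prod_mono_subgroup _ s hs')).trans ?_
    exact Nat.mul_le_mul_right _ (kPi_prime_le hp)

lemma kPi_le_mul (s : Finset ℕ) (hs : ∀ q ∈ s, q.Prime) (p : ℕ) (hp : p ∈ s)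
    (G : Type u) [Group G] [Finite G] :
    kPi (s : Set ℕ) G ≤ kPi {p} G * ∏ q ∈ s.erase p, q ^ (Nat.card G).factorization q := by
  have hs' : ∀ q ∈ s.erase p, q.Prime := fun q hq => hs q (Finset.mem_of_mem_erase hq)
  rw [← Finset.insert_erase hp, Finset.coe_insert, Finset.erase_insert_eq_erase,
    Finset.erase_idem]
  exact kPi_insert_le (hs p hp) _ _
      fun x => (kPi_le _ hs' _).trans (prod_mono_subgroup _ _ hs')

lemma exists_surj {G : Type*} [Group G] [Finite G] {p : ℕ} (hp : p.Prime)
    (h3 : p ≠ 3 ∨ Odd (Nat.card G))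
    (hk : ¬ 8 * kPi {p} G ≤ 5 * p ^ (Nat.card G).factorization p) :
    ∃ P : Subgroup G, Nat.card P = p ^ (Nat.card G).factorization p ∧
      (∀ a b : P, a * b = b * a) ∧ ∃ f : G →* P, Function.Surjective f := by
  have := Fact.mk hp
  let P : Sylow p G := default
  rw [← P.card_eq_multiplicity] at hk ⊢
  have hP : ∀ a b : P, a * b = b * a := by
    by_contra h
    exact hk (nonabelian_case P h)
  have hN : Subgroup.normalizer (P : Set G) ≤ Subgroup.centralizer (P : Set G) := by
    by_contra h
    exact hk (abelian_case P hP h3 h)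
  refine ⟨P, rfl, hP, MonoidHom.transferSylow P hN, ?_⟩
  intro y
  obtain ⟨x, hx⟩ := (P.2.powEquiv' P.not_dvd_index).surjective y
  refine ⟨x, ?_⟩
  rw [MonoidHom.transferSylow_eq_pow P hN x x.2, ← hx]
  rfl

lemma le_kPi {G : Type*} [Group G] [Finite G] (s : Finset ℕ) (hs : ∀ q ∈ s, q.Prime)
    (H : ∀ p ∈ s, ∃ P : Subgroup G, Nat.card P = p ^ (Nat.card G).factorization p ∧
      (∀ a b : P, a * b = b * a) ∧ ∃ f : G →* P, Function.Surjective f) :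
    ∏ q ∈ s, q ^ (Nat.card G).factorization q ≤ kPi (s : Set ℕ) G := by
  set a := ∏ q ∈ s, q ^ (Nat.card G).factorization q with ha
  have hcopr : ∀ i ∈ s, ∀ j ∈ s, i ≠ j → Nat.Coprime (i ^ (Nat.card G).factorization i)
      (j ^ (Nat.card G).factorization j) := fun i hi j hj hij =>
    Nat.Coprime.pow _ _ ((Nat.coprime_primes (hs i hi) (hs j hj)).2 hij)
  have hdvd : ∀ n : ℕ, (∀ q ∈ s, q ^ (Nat.card G).factorization q ∣ n) → a ∣ n := by
    intro n hn
    exact Finset.prod_dvd_of_isRelPrime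
      (fun i hi j hj hij => Nat.coprime_iff_isRelPrime.1 (hcopr i hi j hj hij)) hn
  obtain ⟨b, hb⟩ : a ∣ Nat.card G := hdvd _ fun q hq => Nat.ordProj_dvd _ _
  have hab : a.Coprime b := by
    apply Nat.Coprime.prod_left
    intro q hq
    apply Nat.Coprime.pow_left
    rw [Nat.Prime.coprime_iff_not_dvd (hs q hq)]
    intro hqb
    have h1 : q ^ (Nat.card G).factorization q ∣ a := Finset.dvd_prod_of_mem _ hq
    have h2 : q ^ ((Nat.card G).factorization q + 1) ∣ Nat.card G := by
      rw [pow_succ]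
      exact (mul_dvd_mul h1 hqb).trans hb.symm.dvd
    exact Nat.pow_succ_factorization_not_dvd Nat.card_pos.ne' (hs q hq) h2
  choose P hPc hPab f hf using H
  let ψ : G →* (∀ q : s, P q.1 q.2) := MonoidHom.pi fun q => f q.1 q.2
  have hψcomm : ∀ x y : (∀ q : s, P q.1 q.2), x * y = y * x := fun x y =>
    funext fun q => hPab _ _ _ _
  have hψa : ∀ x : (∀ q : s, P q.1 q.2), x ^ a = 1 := by
    intro x
    funext q
    have h1 : x q ^ Nat.card (P q.1 q.2) = 1 := pow_card_eq_one'
    rw [hPc] at h1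
    obtain ⟨c, hc⟩ : q.1 ^ (Nat.card G).factorization q.1 ∣ a := Finset.dvd_prod_of_mem _ q.2
    rw [Pi.pow_apply, hc, pow_mul, h1, one_pow]; rfl
  have hrange : a ≤ Nat.card ψ.range := by
    refine Nat.le_of_dvd Nat.card_pos (hdvd _ fun q hq => ?_)
    rw [← hPc q hq]
    let g : ψ.range →* P q hq := (Pi.evalMonoidHom _ (⟨q, hq⟩ : s)).comp ψ.range.subtype
    refine Subgroup.card_dvd_of_surjective g ?_
    intro y
    obtain ⟨x, hx⟩ := hf q hq y
    exact ⟨⟨ψ x, x, rfl⟩, hx⟩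
  refine hrange.trans ?_
  have hlift : ∀ y : ψ.range, ∃ x : G, IsPiElement (s : Set ℕ) x ∧ ψ x = y := by
    rintro ⟨_, z, rfl⟩
    obtain ⟨x, w, -, -, hx, hw, hxw⟩ := exists_coprime_decomp z a b hab
      (by rw [← hb]; exact pow_card_eq_one')
    refine ⟨x, isPiElement_of_pow hx ?_, ?_⟩
    · intro q hq hd
      obtain ⟨r, hr, hqr⟩ := (hq.prime.dvd_finsetProd_iff _).1 hd
      have := (Nat.prime_dvd_prime_iff_eq hq (hs r hr)).1 (hq.dvd_of_dvd_pow hqr)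
      rw [this]; exact hr
    · have h1 : ψ w ^ b = 1 := by rw [← map_pow, hw, map_one]
      have h2 : ψ w = 1 := by
        have := Nat.dvd_gcd (orderOf_dvd_of_pow_eq_one (hψa (ψ w)))
          (orderOf_dvd_of_pow_eq_one h1)
        rwa [hab.gcd_eq_one, Nat.dvd_one, orderOf_eq_one_iff] at this
      change ψ x = ψ z
      rw [← hxw, map_mul, h2, mul_one]
  choose L hL1 hL2 using hlift
  refine Nat.card_le_card_of_injective
    (fun y => (⟨ConjClasses.mk (L y), L y, rfl, hL1 y⟩ : PiClasses (s : Set ℕ) G)) ?_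
  intro y y' h
  have h' := congrArg Subtype.val h
  obtain ⟨c, hc⟩ := isConj_iff.1 (ConjClasses.mk_eq_mk_iff_isConj.1 h')
  apply Subtype.ext
  rw [← hL2 y, ← hL2 y', ← hc, map_mul, map_mul, hψcomm (ψ c), mul_assoc, ← map_mul,
    mul_inv_cancel, map_one, mul_one]

/-- If `d_π(G) < 1` and either `3 ∉ π` or `|G|` is odd, then `d_π(G) ≤ 5/8`. -/
theorem dPi_le_five_eighths_of_dPi_lt_one
    {G : Type*} [Group G] [Finite G] (π : Set ℕ)
    (hπ : ∀ p ∈ π, Nat.Prime p) (h : dPi π G < 1)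
    (h3 : 3 ∉ π ∨ Odd (Nat.card G)) :
    dPi π G ≤ 5 / 8 := by
  set s : Finset ℕ := (Nat.card G).primeFactors.filter (· ∈ π) with hsdef
  have hs : ∀ q ∈ s, q.Prime := fun q hq =>
    Nat.prime_of_mem_primeFactors (Finset.mem_filter.1 hq).1
  have hpart : piPart π (Nat.card G) = ∏ q ∈ s, q ^ (Nat.card G).factorization q := by
    rw [hsdef, Finset.prod_filter]
    rfl
  have hk : kPi π G = kPi (s : Set ℕ) G := by
    have : ∀ x : G, IsPiElement π x ↔ IsPiElement (s : Set ℕ) x := by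
      intro x
      refine forall_congr' fun q => forall_congr' fun hq => forall_congr' fun hd => ?_
      rw [Finset.mem_coe, hsdef, Finset.mem_filter]
      refine ⟨fun h => ⟨?_, h⟩, fun h => h.2⟩
      exact Nat.mem_primeFactors.2 ⟨hq, hd.trans (orderOf_dvd_natCard x), Nat.card_pos.ne'⟩
    unfold kPi
    simp only [this]
  have hpos : 0 < ∏ q ∈ s, q ^ (Nat.card G).factorization q :=
    Finset.prod_pos fun q hq => pow_pos (hs q hq).pos _
  unfold dPi at h ⊢
  rw [hk, hpart] at h ⊢
  have hposQ : (0 : ℚ) < ((∏ q ∈ s, q ^ (Nat.card G).factorization q : ℕ) : ℚ) := by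
    exact_mod_cast hpos
  rw [div_lt_one hposQ, Nat.cast_lt] at h
  by_contra hcon
  refine absurd (le_kPi s hs ?_) (not_le.2 h)
  intro p hp
  apply exists_surj (hs p hp)
  · rcases h3 with h3 | h3
    · left
      rintro rfl
      exact h3 (Finset.mem_filter.1 hp).2
    · exact Or.inr h3
  · intro h8
    apply hcon
    rw [div_le_div_iff₀ hposQ (by norm_num)]
    have h1 := kPi_le_mul s hs p hp G
    have h2 := Finset.mul_prod_erase s (fun q => q ^ (Nat.card G).factorization q) hp
    have h4 : kPi (s : Set ℕ) G * 8 ≤ 5 * ∏ q ∈ s, q ^ (Nat.card G).factorization q := by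
      rw [← h2]
      calc _ ≤ (kPi {p} G * ∏ q ∈ s.erase p, q ^ (Nat.card G).factorization q) * 8 := by gcongr
        _ = (8 * kPi {p} G) * ∏ q ∈ s.erase p, q ^ (Nat.card G).factorization q := by ring
        _ ≤ _ := Nat.mul_le_mul_right _ h8
        _ = _ := by ring
    exact_mod_cast h4
end

section
/- Let G be a finite group, π a set of primes, and N a normal subgroup of G. Then d_π(G) ≤ d_π(N) · d_π(G/N). -/
open scoped Classical Pointwise

theorem piPart_pos (π : Set ℕ) (m : ℕ) : 0 < piPart π m := by
  unfold piPart
  refine Finset.prod_pos fun p hp => ?_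
  have := (Nat.prime_of_mem_primeFactors (by simpa using hp)).pos
  dsimp only
  split_ifs <;> positivity

theorem piPart_mul (π : Set ℕ) (m n : ℕ) (hm : m ≠ 0) (hn : n ≠ 0) :
    piPart π (m * n) = piPart π m * piPart π n := by
  unfold piPart
  rw [Nat.factorization_mul hm hn]
  apply Finsupp.prod_add_index'
  · intro a; simp
  · intro a b c; split_ifs <;> simp [pow_add]

theorem piPart_mul_compl (π : Set ℕ) (m : ℕ) (hm : m ≠ 0) :
    piPart π m * piPart πᶜ m = m := by
  conv_rhs => rw [← Nat.prod_factorization_pow_eq_self hm]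
  unfold piPart
  rw [← Finsupp.prod_mul]
  refine Finsupp.prod_congr fun p hp => ?_
  by_cases h : p ∈ π <;> simp [h]

theorem prime_dvd_piPart (π : Set ℕ) (m q : ℕ) (hq : q.Prime) (h : q ∣ piPart π m) : q ∈ π := by
  unfold piPart Finsupp.prod at h
  obtain ⟨p, hp, hd⟩ := (hq.prime.dvd_finsetProd_iff _).1 h
  have hpp : p.Prime := Nat.prime_of_mem_primeFactors (by simpa using hp)
  dsimp only at hd
  split_ifs at hd with hpi
  · rwa [(Nat.prime_dvd_prime_iff_eq hq hpp).1 (hq.dvd_of_dvd_pow hd)]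
  · exact absurd hd hq.not_dvd_one

theorem coprime_parts (π : Set ℕ) (m : ℕ) : (piPart π m).Coprime (piPart πᶜ m) := by
  refine Nat.coprime_of_dvd fun q hq h1 h2 => ?_
  exact prime_dvd_piPart _ _ _ hq h2 (prime_dvd_piPart _ _ _ hq h1)

theorem isPi_iff {G : Type*} [Group G] (π : Set ℕ) (m : ℕ) (hm : m ≠ 0) (x : G) (hx : x ^ m = 1) :
    IsPiElement π x ↔ x ^ piPart π m = 1 := by
  rw [← orderOf_dvd_iff_pow_eq_one]
  constructor
  · intro h
    have h1 := orderOf_dvd_of_pow_eq_one hx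
    rw [← piPart_mul_compl π m hm] at h1
    refine Nat.Coprime.dvd_of_dvd_mul_right (Nat.coprime_of_dvd fun q hq h1 h2 => ?_) h1
    exact prime_dvd_piPart _ _ _ hq h2 (h q hq h1)
  · intro h q hq hd
    exact prime_dvd_piPart _ _ _ hq (hd.trans h)

/-- Number of commuting pairs with first entry a `π`-element. -/
noncomputable def piPairs (π : Set ℕ) (G : Type*) [Group G] : ℕ :=
  Nat.card {p : G × G // IsPiElement π p.1 ∧ Commute p.1 p.2}

theorem isPi_conj {G : Type*} [Group G] (π : Set ℕ) {x y : G} (h : IsConj x y)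
    (hx : IsPiElement π x) : IsPiElement π y := by
  obtain ⟨c, rfl⟩ := isConj_iff.1 h
  intro q hq hd
  refine hx q hq ?_
  have : orderOf (c * x * c⁻¹) = orderOf x := (MulAut.conj c).orderOf_eq x
  rwa [this] at hd

theorem card_class_mul {G : Type*} [Group G] [Finite G] (x : G) :
    Nat.card {h : G // Commute x h} * Nat.card {y : G // IsConj x y} = Nat.card G := by
  have h := Subgroup.card_eq_card_quotient_mul_card_subgroup (MulAction.stabilizer (ConjAct G) x)
  rw [← Nat.card_congr (MulAction.orbitEquivQuotientStabilizer (ConjAct G) x),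
    ← Subgroup.nat_card_centralizer_nat_card_stabilizer] at h
  have e1 : Nat.card (Subgroup.centralizer {x}) = Nat.card {h : G // Commute x h} := by
    refine Nat.card_congr (Equiv.subtypeEquivRight fun y => ?_)
    rw [Subgroup.mem_centralizer_singleton_iff]
    first | exact Iff.rfl | exact eq_comm
  have e2 : Nat.card (MulAction.orbit (ConjAct G) x) = Nat.card {y : G // IsConj x y} := by
    refine Nat.card_congr (Equiv.subtypeEquivRight fun y => ?_)
    rw [ConjAct.mem_orbit_conjAct, isConj_comm]
  rw [e1, e2] at h
  rw [mul_comm, ← h]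
  rfl

theorem piPairs_eq {G : Type*} [Group G] [Finite G] (π : Set ℕ) :
    piPairs π G = kPi π G * Nat.card G := by
  have : Fintype G := Fintype.ofFinite G
  have : Fintype (ConjClasses G) := Fintype.ofFinite _
  let e : {p : G × G // IsPiElement π p.1 ∧ Commute p.1 p.2} ≃
      Σ c : {c : ConjClasses G | ∃ x : G, ConjClasses.mk x = c ∧ IsPiElement π x},
        Σ y : {y : G // ConjClasses.mk y = c.1}, {h : G // Commute y.1 h} :=
    { toFun := fun p => ⟨⟨ConjClasses.mk p.1.1, p.1.1, rfl, p.2.1⟩, ⟨p.1.1, rfl⟩, ⟨p.1.2, p.2.2⟩⟩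
      invFun := fun q => ⟨(q.2.1.1, q.2.2.1), by
        obtain ⟨⟨c, x, rfl, hx⟩, ⟨y, hy⟩, ⟨h, hh⟩⟩ := q
        exact ⟨isPi_conj π (ConjClasses.mk_eq_mk_iff_isConj.1 hy).symm hx, hh⟩⟩
      left_inv := fun p => rfl
      right_inv := fun q => by
        obtain ⟨⟨c, x, hc, hx⟩, ⟨y, hy⟩, ⟨h, hh⟩⟩ := q
        dsimp only at hy
        subst hy
        rfl }
  unfold piPairs kPi
  rw [Nat.card_congr e, Nat.card_sigma, Finset.sum_congr rfl (g := fun _ => Nat.card G),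
    Finset.sum_const, Finset.card_univ, ← Nat.card_eq_fintype_card, smul_eq_mul]
  rintro ⟨c, x, rfl, hx⟩ -
  rw [Nat.card_sigma]
  have hpos : 0 < Nat.card {y : G // IsConj x y} := by
    have : Nonempty {y : G // IsConj x y} := ⟨x, IsConj.refl x⟩
    exact Nat.card_pos
  refine Nat.eq_of_mul_eq_mul_right hpos ?_
  rw [Finset.sum_mul, Finset.sum_congr rfl (g := fun _ => Nat.card G),
    Finset.sum_const, Finset.card_univ, ← Nat.card_eq_fintype_card, smul_eq_mul, mul_comm]
  · congr 1
    refine Nat.card_congr (Equiv.subtypeEquivRight fun y => ?_)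
    rw [ConjClasses.mk_eq_mk_iff_isConj, isConj_comm]
  · rintro ⟨y, hy⟩ -
    have hy := ConjClasses.mk_eq_mk_iff_isConj.1 hy
    rw [← card_class_mul y]
    congr 1
    refine Nat.card_congr (Equiv.subtypeEquivRight fun z => ?_)
    exact ⟨fun h => hy.trans h, fun h => hy.symm.trans h⟩

/-- centralizer bound -/
theorem card_cent_le {G : Type*} [Group G] [Finite G] (N : Subgroup G) [N.Normal] (x : G) :
    Nat.card {h : G // Commute x h} ≤
      Nat.card {H : G ⧸ N // Commute (x : G ⧸ N) H} * Nat.card {n : N // Commute x n} := by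
  have : Fintype {H : G ⧸ N // Commute (x : G ⧸ N) H} := Fintype.ofFinite _
  have hc : ∀ h : G, Commute x h → Commute (x : G ⧸ N) (h : G ⧸ N) := fun h hh =>
    hh.map (QuotientGroup.mk' N)
  let f : {h : G // Commute x h} → {H : G ⧸ N // Commute (x : G ⧸ N) H} :=
    fun h => ⟨h.1, hc _ h.2⟩
  rw [← Nat.card_congr (Equiv.sigmaFiberEquiv f), Nat.card_sigma]
  refine (Finset.sum_le_card_nsmul _ _ (Nat.card {n : N // Commute x n}) fun H _ => ?_).trans ?_
  · rcases isEmpty_or_nonempty {h // f h = H} with he | ⟨⟨h0, hh0⟩⟩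
    · simp
    · have hm : ∀ h : {h // f h = H}, h0.1⁻¹ * h.1.1 ∈ N := fun h => by
        rw [← QuotientGroup.eq]
        exact congrArg Subtype.val (hh0.trans h.2.symm)
      refine Nat.card_le_card_of_injective
        (fun h => ⟨⟨h0.1⁻¹ * h.1.1, hm h⟩, h0.2.inv_right.mul_right h.1.2⟩) ?_
      intro a b hab
      have := congrArg (fun t => ((t.1 : N) : G)) hab
      exact Subtype.ext (Subtype.ext (mul_left_cancel this))
  · rw [Finset.card_univ, smul_eq_mul, ← Nat.card_eq_fintype_card]

/-- coset bound -/
theorem coset_le {G : Type*} [Group G] [Finite G] (N : Subgroup G) [N.Normal] (s : N)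
    (X : G ⧸ N) :
    Nat.card {z : G // (z : G ⧸ N) = X ∧ Commute (s : G) z} ≤ Nat.card {n : N // Commute s n} := by
  rcases isEmpty_or_nonempty {z : G // (z : G ⧸ N) = X ∧ Commute (s : G) z} with he | ⟨⟨h0, hh0⟩⟩
  · simp
  · have hm : ∀ h : {z : G // (z : G ⧸ N) = X ∧ Commute (s : G) z}, h0⁻¹ * h.1 ∈ N := fun h => by
      rw [← QuotientGroup.eq]
      exact (hh0.1.trans h.2.1.symm)
    refine Nat.card_le_card_of_injective
      (fun h => ⟨⟨h0⁻¹ * h.1, hm h⟩, ?_⟩) ?_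
    · exact Subtype.ext (hh0.2.inv_right.mul_right h.2.2)
    intro a b hab
    have := congrArg (fun t => ((t.1 : N) : G)) hab
    exact (Subtype.ext (mul_left_cancel this))

theorem isPi_coe {G : Type*} [Group G] (N : Subgroup G) (π : Set ℕ) (s : N) :
    IsPiElement π s ↔ IsPiElement π (s : G) := by
  unfold IsPiElement
  rw [Subgroup.orderOf_coe]

theorem swap_le {G : Type*} [Group G] [Finite G] (π : Set ℕ) (N : Subgroup G) [N.Normal]
    (X : G ⧸ N) :
    Nat.card {p : G × N // ((p.1 : G ⧸ N) = X ∧ IsPiElement π p.1) ∧ Commute p.1 (p.2 : G)} ≤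
    Nat.card {p : N × G // IsPiElement π p.1 ∧ (p.2 : G ⧸ N) = X ∧ Commute (p.1 : G) p.2} := by
  have hm : Nat.card G ≠ 0 := Nat.card_pos.ne'
  have hG : ∀ x : G, x ^ Nat.card G = 1 := fun x => pow_card_eq_one'
  have hco := coprime_parts π (Nat.card G)
  have hab := piPart_mul_compl π (Nat.card G) hm
  have hpi : ∀ x : G, IsPiElement π x ↔ x ^ piPart π (Nat.card G) = 1 :=
    fun x => isPi_iff π _ hm x (hG x)
  generalize piPart π (Nat.card G) = a at *
  generalize piPart πᶜ (Nat.card G) = b at *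
  obtain ⟨e, he1, he0⟩ := Nat.chineseRemainder hco 1 0
  obtain ⟨f, hf0, hf1⟩ := Nat.chineseRemainder hco 0 1
  have key : ∀ (x : G) (i j : ℕ), i ≡ j [MOD a] → i ≡ j [MOD b] → x ^ i = x ^ j := by
    intro x i j h1 h2
    rw [pow_eq_pow_iff_modEq]
    have : i ≡ j [MOD a * b] := (Nat.modEq_and_modEq_iff_modEq_mul hco).1 ⟨h1, h2⟩
    rw [hab] at this
    exact this.of_dvd (orderOf_dvd_natCard x)
  have keya : ∀ (x : G) (i j : ℕ), x ^ a = 1 → i ≡ j [MOD a] → x ^ i = x ^ j := by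
    intro x i j h1 h2
    rw [pow_eq_pow_iff_modEq]
    exact h2.of_dvd (orderOf_dvd_of_pow_eq_one h1)
  have hef : ∀ x : G, x ^ e * x ^ f = x := fun x => by
    rw [← pow_add]
    conv_rhs => rw [← pow_one x]
    exact key x _ _ (by simpa using he1.add hf0) (by simpa using he0.add hf1)
  have hfe : ∀ x : G, (x ^ f) ^ e = 1 := fun x => by
    rw [← pow_mul, ← pow_zero x]
    exact key x _ _ (by simpa using hf0.mul_right e) (by simpa using he0.mul_left f)
  have hff : ∀ x : G, (x ^ f) ^ f = x ^ f := fun x => by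
    rw [← pow_mul]
    exact key x _ _ ((by simpa using hf0.mul_right f : f * f ≡ 0 [MOD a]).trans hf0.symm) (by simpa using hf1.mul_right f)
  have hea : ∀ x : G, (x ^ e) ^ a = 1 := fun x => by
    rw [← pow_mul, ← pow_zero x]
    exact key x _ _ ((Nat.modEq_zero_iff_dvd).2 (dvd_mul_left a e))
      (by simpa using he0.mul_right a)
  have hxe : ∀ x : G, x ^ a = 1 → x ^ e = x := fun x hx => by
    rw [keya x e 1 hx he1, pow_one]
  have hxf : ∀ x : G, x ^ a = 1 → x ^ f = 1 := fun x hx => by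
    rw [keya x f 0 hx hf0, pow_zero]
  refine Nat.card_le_card_of_injective (fun p => ⟨(p.1.2 ^ e, p.1.1 * (p.1.2 : G) ^ f), ?_⟩) ?_
  · obtain ⟨⟨x, n⟩, ⟨hX, hx⟩, hc⟩ := p
    dsimp only at hX hx hc ⊢
    refine ⟨?_, ?_, ?_⟩
    · rw [isPi_coe, hpi]
      push_cast
      exact hea _
    · rw [← hX]
      exact QuotientGroup.mk_mul_of_mem x (N.pow_mem n.2 f)
    · push_cast
      exact (hc.symm.pow_left e).mul_right ((Commute.refl (n : G)).pow_pow e f)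
  · rintro ⟨⟨x, n⟩, ⟨hX, hx⟩, hc⟩ ⟨⟨x', n'⟩, ⟨hX', hx'⟩, hc'⟩ h
    dsimp only at hX hx hc hX' hx' hc'
    rw [hpi] at hx hx'
    have h1 : ((n : G)) ^ e = (n' : G) ^ e := by
      simpa using congrArg (fun t => ((t.1.1 : N) : G)) h
    have h2 : x * (n : G) ^ f = x' * (n' : G) ^ f := congrArg (fun t => t.1.2) h
    have hx2 : x = x' := by
      have := congrArg (· ^ e) h2
      simpa [(hc.pow_right f).mul_pow, (hc'.pow_right f).mul_pow, hfe, hxe _ hx, hxe _ hx']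
        using this
    subst hx2
    have h3 := mul_left_cancel h2
    have h4 : n = n' := Subtype.ext (by rw [← hef n, ← hef n', h1, h3])
    subst h4
    rfl

theorem coset_total {G : Type*} [Group G] [Finite G] (π : Set ℕ) (N : Subgroup G) [N.Normal]
    (X : G ⧸ N) :
    Nat.card {p : G × N // ((p.1 : G ⧸ N) = X ∧ IsPiElement π p.1) ∧ Commute p.1 (p.2 : G)} ≤
      piPairs π N := by
  refine (swap_le π N X).trans ?_
  have : Fintype {s : N // IsPiElement π s} := Fintype.ofFinite _
  let e1 : {p : N × G // IsPiElement π p.1 ∧ (p.2 : G ⧸ N) = X ∧ Commute (p.1 : G) p.2} ≃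
      Σ s : {s : N // IsPiElement π s}, {z : G // (z : G ⧸ N) = X ∧ Commute (s.1 : G) z} :=
    { toFun := fun p => ⟨⟨p.1.1, p.2.1⟩, ⟨p.1.2, p.2.2⟩⟩
      invFun := fun q => ⟨(q.1.1, q.2.1), q.1.2, q.2.2⟩
      left_inv := fun _ => rfl
      right_inv := fun _ => rfl }
  let e2 : {p : N × N // IsPiElement π p.1 ∧ Commute p.1 p.2} ≃
      Σ s : {s : N // IsPiElement π s}, {n : N // Commute s.1 n} :=
    { toFun := fun p => ⟨⟨p.1.1, p.2.1⟩, ⟨p.1.2, p.2.2⟩⟩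
      invFun := fun q => ⟨(q.1.1, q.2.1), q.1.2, q.2.2⟩
      left_inv := fun _ => rfl
      right_inv := fun _ => rfl }
  unfold piPairs
  rw [Nat.card_congr e1, Nat.card_congr e2, Nat.card_sigma, Nat.card_sigma]
  exact Finset.sum_le_sum fun s _ => coset_le N s.1 X

theorem piPairs_le {G : Type*} [Group G] [Finite G] (π : Set ℕ) (N : Subgroup G) [N.Normal] :
    piPairs π G ≤ piPairs π (G ⧸ N) * piPairs π N := by
  have hq : ∀ x : G, IsPiElement π x → IsPiElement π (x : G ⧸ N) := fun x hx q hq hd =>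
    hx q hq (hd.trans (orderOf_map_dvd (QuotientGroup.mk' N) x))
  have : Fintype {X : G ⧸ N // IsPiElement π X} := Fintype.ofFinite _
  have : ∀ X : G ⧸ N, Fintype {x : G // (x : G ⧸ N) = X ∧ IsPiElement π x} :=
    fun _ => Fintype.ofFinite _
  let e1 : {p : G × G // IsPiElement π p.1 ∧ Commute p.1 p.2} ≃
      Σ X : {X : G ⧸ N // IsPiElement π X},
        Σ x : {x : G // (x : G ⧸ N) = X.1 ∧ IsPiElement π x}, {h : G // Commute x.1 h} :=
    { toFun := fun p => ⟨⟨p.1.1, hq _ p.2.1⟩, ⟨p.1.1, rfl, p.2.1⟩, ⟨p.1.2, p.2.2⟩⟩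
      invFun := fun q => ⟨(q.2.1.1, q.2.2.1), q.2.1.2.2, q.2.2.2⟩
      left_inv := fun _ => rfl
      right_inv := fun q => by
        obtain ⟨⟨X, hX⟩, ⟨x, hx, hx'⟩, h⟩ := q
        dsimp only at hx
        subst hx
        rfl }
  let e2 : {p : (G ⧸ N) × (G ⧸ N) // IsPiElement π p.1 ∧ Commute p.1 p.2} ≃
      Σ X : {X : G ⧸ N // IsPiElement π X}, {n : G ⧸ N // Commute X.1 n} :=
    { toFun := fun p => ⟨⟨p.1.1, p.2.1⟩, ⟨p.1.2, p.2.2⟩⟩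
      invFun := fun q => ⟨(q.1.1, q.2.1), q.1.2, q.2.2⟩
      left_inv := fun _ => rfl
      right_inv := fun _ => rfl }
  have e3 : ∀ X : G ⧸ N,
      {p : G × N // ((p.1 : G ⧸ N) = X ∧ IsPiElement π p.1) ∧ Commute p.1 (p.2 : G)} ≃
      Σ x : {x : G // (x : G ⧸ N) = X ∧ IsPiElement π x}, {n : N // Commute x.1 (n : G)} := fun X =>
    { toFun := fun p => ⟨⟨p.1.1, p.2.1⟩, ⟨p.1.2, p.2.2⟩⟩
      invFun := fun q => ⟨(q.1.1, q.2.1), q.1.2, q.2.2⟩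
      left_inv := fun _ => rfl
      right_inv := fun _ => rfl }
  have hA : piPairs π (G ⧸ N) =
      ∑ X : {X : G ⧸ N // IsPiElement π X}, Nat.card {n : G ⧸ N // Commute X.1 n} := by
    unfold piPairs
    rw [Nat.card_congr e2, Nat.card_sigma]
  have hB : piPairs π G = ∑ X : {X : G ⧸ N // IsPiElement π X},
      ∑ x : {x : G // (x : G ⧸ N) = X.1 ∧ IsPiElement π x}, Nat.card {h : G // Commute x.1 h} := by
    unfold piPairs
    rw [Nat.card_congr e1, Nat.card_sigma]
    exact Finset.sum_congr rfl fun X _ => Nat.card_sigma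
  rw [hA, hB, Finset.sum_mul]
  refine Finset.sum_le_sum fun X _ => ?_
  refine le_trans ?_ (Nat.mul_le_mul_left _ (coset_total π N X.1))
  rw [Nat.card_congr (e3 X.1), Nat.card_sigma, Finset.mul_sum]
  refine Finset.sum_le_sum fun x _ => ?_
  have := card_cent_le N x.1
  rwa [x.2.1] at this

/-- Fulman–Guralnick: `d_π(G) ≤ d_π(N) · d_π(G/N)` for `N` normal in `G`. -/
theorem dPi_le_dPi_mul_dPi_quotient
    {G : Type*} [Group G] [Finite G] (π : Set ℕ)
    (hπ : ∀ p ∈ π, Nat.Prime p)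
    (N : Subgroup G) (hN : N.Normal) :
    dPi π G ≤ dPi π N * dPi π (G ⧸ N) := by
  have h := piPairs_le π N
  have hc := Subgroup.card_eq_card_quotient_mul_card_subgroup N
  have hk : kPi π G ≤ kPi π N * kPi π (G ⧸ N) := by
    rw [piPairs_eq, piPairs_eq, piPairs_eq] at h
    have hpos : 0 < Nat.card G := Nat.card_pos
    refine Nat.le_of_mul_le_mul_right (h.trans_eq ?_) hpos
    rw [hc]
    ring
  unfold dPi
  rw [hc, piPart_mul _ _ _ Nat.card_pos.ne' Nat.card_pos.ne', div_mul_div_comm,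
    mul_comm (piPart π (Nat.card (G ⧸ N)))]
  push_cast
  gcongr
  exact_mod_cast hk
end
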